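/- Let k be a field, let V be a finite-dimensional k-vector space, let G be a group and let ρ : G → GL(V) be a linear representation such that the subspace of G-invariant vectors of V is zero and the subspace of G-invariant vectors of the dual representation on V* is also zero. For g ∈ G write d_g for the dimension of the fixed-point subspace {v ∈ V : ρ(g)v = v}. If x, y, z ∈ G satisfy x·y·z = 1 and the subgroup generated by x and y is all of G, then d_x + d_y + d_z ≤ dim V. -/

import Mathlib

theorem scott_aux_inv {k : Type*} [Field k] {V : Type*} [AddCommGroup V] [Module k V]
    {G : Type*} [Group G] (ρ : Representation k G V) (h : ρ.invariants = ⊥) (x y : G)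
    (hgen : Subgroup.closure ({x, y} : Set G) = ⊤) (v : V) (hx : ρ x v = v) (hy : ρ y v = v) :
    v = 0 := by
  have hm : v ∈ ρ.invariants := by
    intro g
    have hg : g ∈ Subgroup.closure ({x, y} : Set G) := by rw [hgen]; trivial
    induction hg using Subgroup.closure_induction with
    | mem a ha =>
      rcases ha with rfl | rfl
      · exact hx
      · exact hy
    | one => simp
    | mul a b _ _ ha hb => rw [map_mul, Module.End.mul_apply, hb, ha]
    | inv a _ ha =>
      conv_lhs => rw [← ha]
      rw [← Module.End.mul_apply, ← map_mul]
      simp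
  rw [h] at hm
  simpa using hm

/-- Scott's theorem (specialisation used in the paper): if `ρ : G → GL(V)` is a
representation with trivial fixed-point space on `V` and on the dual `V*`, and
`x * y * z = 1` with `⟨x, y⟩ = G`, then the sum of the dimensions of the
fixed-point spaces of `x`, `y` and `z` is at most `dim V`. -/
theorem scott_theorem_specialisation
    {k : Type*} [Field k] {V : Type*} [AddCommGroup V] [Module k V]
    [FiniteDimensional k V] {G : Type*} [Group G]
    (ρ : Representation k G V)
    (hV : ρ.invariants = ⊥)
    (hVdual : ρ.dual.invariants = ⊥)
    (x y z : G) (hxyz : x * y * z = 1)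
    (hgen : Subgroup.closure ({x, y} : Set G) = ⊤) :
    Module.finrank k (LinearMap.ker (ρ x - 1))
      + Module.finrank k (LinearMap.ker (ρ y - 1))
      + Module.finrank k (LinearMap.ker (ρ z - 1))
      ≤ Module.finrank k V := by
  have hz : ∀ v, ρ x (ρ y (ρ z v)) = v := by
    intro v
    rw [← Module.End.mul_apply, ← Module.End.mul_apply, ← map_mul, ← map_mul, hxyz]
    simp
  let X := ρ x - 1
  let Y := ρ y - 1
  let Z := ρ z - 1
  let β : V →ₗ[k] (LinearMap.range X × LinearMap.range Y × LinearMap.range Z) :=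
    X.rangeRestrict.prod (Y.rangeRestrict.prod Z.rangeRestrict)
  let δ : (LinearMap.range X × LinearMap.range Y × LinearMap.range Z) →ₗ[k] V :=
    (LinearMap.range X).subtype.coprod
      ((ρ x ∘ₗ (LinearMap.range Y).subtype).coprod
        (ρ x ∘ₗ ρ y ∘ₗ (LinearMap.range Z).subtype))
  have hβ : Function.Injective β := by
    rw [← LinearMap.ker_eq_bot, LinearMap.ker_eq_bot']
    intro v hv
    have h1 : X v = 0 := congrArg (fun p => (p.1 : V)) hv
    have h2 : Y v = 0 := congrArg (fun p => (p.2.1 : V)) hv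
    exact scott_aux_inv ρ hV x y hgen v (sub_eq_zero.mp h1) (sub_eq_zero.mp h2)
  have hδβ : ∀ v, δ (β v) = 0 := by
    intro v
    have : δ (β v) = (ρ x v - v) + (ρ x (ρ y v - v) + ρ x (ρ y (ρ z v - v))) := rfl
    rw [this]
    simp only [map_sub, hz]
    abel
  have hδ : LinearMap.range δ = ⊤ := by
    by_contra hne
    obtain ⟨f, hf0, hf⟩ := Submodule.exists_le_ker_of_lt_top _ (lt_top_iff_ne_top.mpr hne)
    apply hf0
    have hfδ : ∀ p, f (δ p) = 0 := fun p => hf ⟨p, rfl⟩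
    have hx : ∀ v, f (ρ x v) = f v := by
      intro v
      have h := hfδ (⟨X v, v, rfl⟩, 0, 0)
      have e : δ (⟨X v, v, rfl⟩, 0, 0) = ρ x v - v := by simp [δ, X]
      rw [e, map_sub] at h
      exact sub_eq_zero.mp h
    have hy : ∀ v, f (ρ y v) = f v := by
      intro v
      have h := hfδ (0, ⟨Y v, v, rfl⟩, 0)
      have e : δ (0, ⟨Y v, v, rfl⟩, 0) = ρ x (ρ y v - v) := by simp [δ, Y]
      rw [e, hx, map_sub] at h
      exact sub_eq_zero.mp h
    refine scott_aux_inv ρ.dual hVdual x y hgen f ?_ ?_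
    · ext v
      change f (ρ x⁻¹ v) = f v
      rw [← hx, ← Module.End.mul_apply, ← map_mul]
      simp
    · ext v
      change f (ρ y⁻¹ v) = f v
      rw [← hy, ← Module.End.mul_apply, ← map_mul]
      simp
  have h1 := LinearMap.finrank_range_add_finrank_ker δ
  rw [hδ, finrank_top, Module.finrank_prod, Module.finrank_prod] at h1
  have h2 : Module.finrank k V ≤ Module.finrank k (LinearMap.ker δ) :=
    LinearMap.finrank_le_finrank_of_injective (f := β.codRestrict (LinearMap.ker δ) hδβ)
      (fun a b hab => hβ (congrArg Subtype.val hab))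
  have hX := LinearMap.finrank_range_add_finrank_ker X
  have hY := LinearMap.finrank_range_add_finrank_ker Y
  have hZ := LinearMap.finrank_range_add_finrank_ker Z
  change Module.finrank k (LinearMap.ker X) + Module.finrank k (LinearMap.ker Y)
    + Module.finrank k (LinearMap.ker Z) ≤ _
  omega
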